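/- Let T₁ and T₂ be nonempty finite type sets, let p : T₁ × T₂ → ℝ be a prior with p(θ₁,θ₂) > 0 for all (θ₁,θ₂), with marginals p̄₁(θ₁) = Σ_{θ₂∈T₂} p(θ₁,θ₂) and p̄₂(θ₂) = Σ_{θ₁∈T₁} p(θ₁,θ₂) and conditionals p₁(θ₂|θ₁) = p(θ₁,θ₂)/p̄₁(θ₁), p₂(θ₁|θ₂) = p(θ₁,θ₂)/p̄₂(θ₂). Let X, Y be finite action sets and ū^{x,y}(θ₁,θ₂), v̄^{x,y}(θ₁,θ₂) ∈ ℝ be utilities. Suppose there exist m₁ : T₁ → ℝ_{>0} and m₂ : T₂ → ℝ_{>0} such that m₂(θ₂) ū^{x,y}(θ₁,θ₂) = − m₁(θ₁) v̄^{x,y}(θ₁,θ₂) for all x ∈ X, y ∈ Y, θ₁ ∈ T₁, θ₂ ∈ T₂, and set α_i(θ_i) = p̄_i(θ_i)/m_i(θ_i) > 0. Then for every pair of behavioral strategies σ₁ : T₁ → Δ(X), σ₂ : T₂ → Δ(Y), Σ_{θ₁∈T₁} α₁(θ₁) Σ_{θ₂∈T₂} p₁(θ₂|θ₁) Σ_{x∈X}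 Σ_{y∈Y} σ₁(x|θ₁) σ₂(y|θ₂) ū^{x,y}(θ₁,θ₂) + Σ_{θ₂∈T₂} α₂(θ₂) Σ_{θ₁∈T₁} p₂(θ₁|θ₂) Σ_{x∈X} Σ_{y∈Y} σ₁(x|θ₁) σ₂(y|θ₂) v̄^{x,y}(θ₁,θ₂) = 0; hence the bilinear terms in the objective of the equilibrium program vanish identically and the program becomes linear. -/

import Mathlib

open Finset

/-- linear program reformulation: in a finite Bayesian game with strictly
positive prior `p`, if there exist positive weights `m₁, m₂` with
`m₂(θ₂) ū^{x,y}(θ₁,θ₂) = − m₁(θ₁) v̄^{x,y}(θ₁,θ₂)` everywhere, then with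
`αᵢ(θᵢ) = p̄ᵢ(θᵢ)/mᵢ(θᵢ)` the two bilinear terms of the equilibrium program sum to zero for
every pair of behavioral strategies, so the program becomes linear. -/
theorem bilinear_terms_vanish_linear_program
    {T₁ T₂ X Y : Type*} [Fintype T₁] [Fintype T₂] [Fintype X] [Fintype Y]
    [Nonempty T₁] [Nonempty T₂] [Nonempty X] [Nonempty Y]
    (p : T₁ → T₂ → ℝ) (hp_pos : ∀ θ₁ θ₂, 0 < p θ₁ θ₂)
    (ubar vbar : X → Y → T₁ → T₂ → ℝ)
    (m₁ : T₁ → ℝ) (m₂ : T₂ → ℝ)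
    (hm₁_pos : ∀ θ₁, 0 < m₁ θ₁) (hm₂_pos : ∀ θ₂, 0 < m₂ θ₂)
    (hzs : ∀ x y θ₁ θ₂, m₂ θ₂ * ubar x y θ₁ θ₂ = -(m₁ θ₁ * vbar x y θ₁ θ₂))
    (α₁ : T₁ → ℝ) (α₂ : T₂ → ℝ)
    (hα₁ : ∀ θ₁, α₁ θ₁ = (∑ θ₂, p θ₁ θ₂) / m₁ θ₁)
    (hα₂ : ∀ θ₂, α₂ θ₂ = (∑ θ₁, p θ₁ θ₂) / m₂ θ₂) :
    (∀ θ₁, 0 < α₁ θ₁) ∧ (∀ θ₂, 0 < α₂ θ₂) ∧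
    ∀ σ₁ : T₁ → X → ℝ, ∀ σ₂ : T₂ → Y → ℝ,
      (∀ θ₁ x, 0 ≤ σ₁ θ₁ x) → (∀ θ₁, ∑ x, σ₁ θ₁ x = 1) →
      (∀ θ₂ y, 0 ≤ σ₂ θ₂ y) → (∀ θ₂, ∑ y, σ₂ θ₂ y = 1) →
        (∑ θ₁, α₁ θ₁ * ∑ θ₂, (p θ₁ θ₂ / ∑ θ₂', p θ₁ θ₂') *
            ∑ x, ∑ y, σ₁ θ₁ x * σ₂ θ₂ y * ubar x y θ₁ θ₂)
          + (∑ θ₂, α₂ θ₂ * ∑ θ₁, (p θ₁ θ₂ / ∑ θ₁', p θ₁' θ₂) *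
            ∑ x, ∑ y, σ₁ θ₁ x * σ₂ θ₂ y * vbar x y θ₁ θ₂) = 0 := by
  have hS₁ : ∀ θ₁, 0 < ∑ θ₂, p θ₁ θ₂ := fun θ₁ =>
    Finset.sum_pos (fun θ₂ _ => hp_pos θ₁ θ₂) Finset.univ_nonempty
  have hS₂ : ∀ θ₂, 0 < ∑ θ₁, p θ₁ θ₂ := fun θ₂ =>
    Finset.sum_pos (fun θ₁ _ => hp_pos θ₁ θ₂) Finset.univ_nonempty
  refine ⟨fun θ₁ => ?_, fun θ₂ => ?_, ?_⟩
  · rw [hα₁]; exact div_pos (hS₁ θ₁) (hm₁_pos θ₁)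
  · rw [hα₂]; exact div_pos (hS₂ θ₂) (hm₂_pos θ₂)
  intro σ₁ σ₂ _ _ _ _
  have hUV : ∀ θ₁ θ₂, m₂ θ₂ * (∑ x, ∑ y, σ₁ θ₁ x * σ₂ θ₂ y * ubar x y θ₁ θ₂)
      = -(m₁ θ₁ * ∑ x, ∑ y, σ₁ θ₁ x * σ₂ θ₂ y * vbar x y θ₁ θ₂) := by
    intro θ₁ θ₂
    simp only [Finset.mul_sum, ← Finset.sum_neg_distrib]
    refine Finset.sum_congr rfl fun x _ => Finset.sum_congr rfl fun y _ => ?_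
    linear_combination (σ₁ θ₁ x * σ₂ θ₂ y) * hzs x y θ₁ θ₂
  generalize hU : (fun θ₁ θ₂ => ∑ x, ∑ y, σ₁ θ₁ x * σ₂ θ₂ y * ubar x y θ₁ θ₂) = U
  generalize hV : (fun θ₁ θ₂ => ∑ x, ∑ y, σ₁ θ₁ x * σ₂ θ₂ y * vbar x y θ₁ θ₂) = V
  have hU' : ∀ θ₁ θ₂, ∑ x, ∑ y, σ₁ θ₁ x * σ₂ θ₂ y * ubar x y θ₁ θ₂ = U θ₁ θ₂ :=
    fun θ₁ θ₂ => congrFun (congrFun hU θ₁) θ₂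
  have hV' : ∀ θ₁ θ₂, ∑ x, ∑ y, σ₁ θ₁ x * σ₂ θ₂ y * vbar x y θ₁ θ₂ = V θ₁ θ₂ :=
    fun θ₁ θ₂ => congrFun (congrFun hV θ₁) θ₂
  simp only [hU', hV'] at hUV ⊢
  have h1 : ∑ θ₁, α₁ θ₁ * ∑ θ₂, (p θ₁ θ₂ / ∑ θ₂', p θ₁ θ₂') * U θ₁ θ₂
      = ∑ θ₁, ∑ θ₂, p θ₁ θ₂ * U θ₁ θ₂ / m₁ θ₁ := by
    refine Finset.sum_congr rfl fun θ₁ _ => ?_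
    rw [Finset.mul_sum]
    refine Finset.sum_congr rfl fun θ₂ _ => ?_
    rw [hα₁]
    have := (hS₁ θ₁).ne'
    have := (hm₁_pos θ₁).ne'
    field_simp
  have h2 : ∑ θ₂, α₂ θ₂ * ∑ θ₁, (p θ₁ θ₂ / ∑ θ₁', p θ₁' θ₂) * V θ₁ θ₂
      = ∑ θ₂, ∑ θ₁, p θ₁ θ₂ * V θ₁ θ₂ / m₂ θ₂ := by
    refine Finset.sum_congr rfl fun θ₂ _ => ?_
    rw [Finset.mul_sum]
    refine Finset.sum_congr rfl fun θ₁ _ => ?_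
    rw [hα₂]
    have := (hS₂ θ₂).ne'
    have := (hm₂_pos θ₂).ne'
    field_simp
  rw [h1, h2, Finset.sum_comm (s := (Finset.univ : Finset T₂)), ← Finset.sum_add_distrib]
  refine Finset.sum_eq_zero fun θ₁ _ => ?_
  rw [← Finset.sum_add_distrib]
  refine Finset.sum_eq_zero fun θ₂ _ => ?_
  have a := (hm₁_pos θ₁).ne'
  have b := (hm₂_pos θ₂).ne'
  rw [div_add_div _ _ a b, div_eq_zero_iff]
  left
  linear_combination p θ₁ θ₂ * hUV θ₁ θ₂
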